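/- Let B be a λ-partition of V_n for some λ > 0 and consider the cyclic dynamics (σ_t) with p = 1/2 and its basket chain (𝐒_t). Fix constants r_0, γ_0 > 0. Suppose either (1) t ≥ (2/3) n log n, or (2) 𝐒_0 ∈ 𝕊^{r_0/√n} and t ≤ γ_0 n. Then there is a constant C > 0 (depending only on λ, r_0, γ_0) such that for all sufficiently large r > 0, all sufficiently large n and all starting configurations σ_0 satisfying the assumed condition, ℙ_{σ_0}( 𝐒_t ∉ 𝕊^{r/√n} ) ≤ C/r². -/

import Mathlib

open Finset
open scoped Classical

/-- Configuration space `Σ_n = {1,2,3}^{V_n}`, colors encoded as `Fin 3`. -/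
abbrev Config (n : ℕ) := Fin n → Fin 3

/-- Transition matrix of the cyclic dynamics with parameter `p` on `Σ_n`. -/
noncomputable def cyclicP (n : ℕ) (p : ℝ) : Matrix (Config n) (Config n) ℝ :=
  Matrix.of fun σ τ => (1 / (n : ℝ)) * ∑ v : Fin n,
    ((1 - p) * (if τ = σ then (1 : ℝ) else 0)
      + p * (if τ = Function.update σ v (σ v + 1) then (1 : ℝ) else 0))

/-- Law of the chain at time `t` started from `σ0`. -/
noncomputable def lawAt (n : ℕ) (p : ℝ) (σ0 : Config n) (t : ℕ) : Config n → ℝ :=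
  fun τ => ((cyclicP n p) ^ t) σ0 τ

/-- `B` is a 3-partition of `V_n` into baskets. -/
def IsPartition {n : ℕ} (B : Fin 3 → Finset (Fin n)) : Prop :=
  (∀ m m' : Fin 3, m ≠ m' → Disjoint (B m) (B m')) ∧ (∀ v : Fin n, ∃ m, v ∈ B m)

/-- Basket-chain matrix `𝐒(σ)^{m,k}`: the proportion of color-`k` vertices within
basket `B_m`. -/
noncomputable def basketS {n : ℕ} (B : Fin 3 → Finset (Fin n)) (σ : Config n)
    (m k : Fin 3) : ℝ :=
  (((B m).filter fun v => σ v = k).card : ℝ) / (B m).card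

/-- Membership in `S^ρ`: a point of the probability simplex in `ℝ³` with
`‖s − ē‖_∞ < ρ`. -/
def inS (ρ : ℝ) (s : Fin 3 → ℝ) : Prop :=
  (∀ k, 0 ≤ s k) ∧ (∑ k, s k) = 1 ∧ (∀ k, |s k - 1/3| < ρ)

/-- Membership in `𝕊^ρ`: every row of the `3×3` matrix lies in `S^ρ`. -/
def inSmat (ρ : ℝ) (M : Fin 3 → Fin 3 → ℝ) : Prop := ∀ m, inS ρ (M m)

/-- The number of vertices of `A` with color `k`, as a real number. -/
noncomputable def colorCount {n : ℕ} (A : Finset (Fin n)) (σ : Config n) (k : Fin 3) : ℝ :=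
  ∑ v ∈ A, if σ v = k then 1 else 0

/-- Squared Euclidean distance of the color counts in `A` from the balanced counts. -/
noncomputable def imbalance {n : ℕ} (A : Finset (Fin n)) (σ : Config n) : ℝ :=
  ∑ k, (colorCount A σ k - (A.card : ℝ) / 3) ^ 2

lemma basketS_eq_colorCount_div {n : ℕ} (B : Fin 3 → Finset (Fin n)) (σ : Config n)
    (m k : Fin 3) : basketS B σ m k = colorCount (B m) σ k / (B m).card := by
  simp [basketS, colorCount]

lemma colorCount_nonneg {n : ℕ} (A : Finset (Fin n)) (σ : Config n) (k : Fin 3) :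
    0 ≤ colorCount A σ k :=
  Finset.sum_nonneg fun v _ => by split_ifs <;> norm_num

lemma sum_colorCount {n : ℕ} (A : Finset (Fin n)) (σ : Config n) :
    ∑ k, colorCount A σ k = A.card := by
  simp only [colorCount]
  rw [Finset.sum_comm]
  simp

lemma sum_mem_comp_color {n : ℕ} (A : Finset (Fin n)) (σ : Config n) (g : Fin 3 → ℝ) :
    ∑ v ∈ A, g (σ v) = ∑ k, colorCount A σ k * g k := by
  simp only [colorCount, Finset.sum_mul]
  rw [Finset.sum_comm]
  simp

lemma colorCount_update_of_mem {n : ℕ} {A : Finset (Fin n)} {v : Fin n} (hv : v ∈ A)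
    (σ : Config n) (j k : Fin 3) :
    colorCount A (Function.update σ v j) k
      = colorCount A σ k - (if σ v = k then 1 else 0) + (if j = k then 1 else 0) := by
  have herase : ∑ w ∈ A.erase v, (if Function.update σ v j w = k then (1 : ℝ) else 0)
      = ∑ w ∈ A.erase v, if σ w = k then (1 : ℝ) else 0 :=
    Finset.sum_congr rfl fun w hw => by
      rw [Function.update_of_ne (Finset.ne_of_mem_erase hw)]
  rw [colorCount, colorCount, ← Finset.add_sum_erase A _ hv, ← Finset.add_sum_erase A _ hv,
    herase, Function.update_self]
  ring

lemma imbalance_update_of_notMem {n : ℕ} {A : Finset (Fin n)} {v : Fin n} (hv : v ∉ A)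
    (σ : Config n) (j : Fin 3) : imbalance A (Function.update σ v j) = imbalance A σ := by
  have hcount : ∀ k, colorCount A (Function.update σ v j) k = colorCount A σ k := fun k =>
    Finset.sum_congr rfl fun w hw => by
      rw [Function.update_of_ne (ne_of_mem_of_not_mem hw hv)]
  simp only [imbalance, hcount]

lemma imbalance_update_succ_of_mem {n : ℕ} {A : Finset (Fin n)} {v : Fin n} (hv : v ∈ A)
    (σ : Config n) :
    imbalance A (Function.update σ v (σ v + 1)) - imbalance A σ
      = 2 + 2 * (colorCount A σ (σ v + 1) - colorCount A σ (σ v)) := by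
  simp only [imbalance, colorCount_update_of_mem hv, Fin.sum_univ_three]
  generalize σ v = i
  fin_cases i <;> simp <;> ring

lemma sum_imbalance_update_sub {n : ℕ} (A : Finset (Fin n)) (σ : Config n) :
    ∑ v, (imbalance A (Function.update σ v (σ v + 1)) - imbalance A σ)
      = 2 * A.card - 3 * imbalance A σ := by
  have hrestrict : ∑ v, (imbalance A (Function.update σ v (σ v + 1)) - imbalance A σ)
      = ∑ v ∈ A, (imbalance A (Function.update σ v (σ v + 1)) - imbalance A σ) :=
    (Finset.sum_subset (Finset.subset_univ A) fun v _ hv => by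
      rw [imbalance_update_of_notMem hv, sub_self]).symm
  rw [hrestrict, Finset.sum_congr rfl fun v hv => imbalance_update_succ_of_mem hv σ,
    sum_mem_comp_color A σ fun i => 2 + 2 * (colorCount A σ (i + 1) - colorCount A σ i)]
  simp only [imbalance, ← sum_colorCount A σ, Fin.sum_univ_three, Fin.isValue, zero_add,
    show (1 : Fin 3) + 1 = 2 from rfl, show (2 : Fin 3) + 1 = 0 from rfl]
  ring

lemma cyclicP_mulVec {n : ℕ} (p : ℝ) (f : Config n → ℝ) (σ : Config n) :
    (cyclicP n p).mulVec f σ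
      = (1 / (n : ℝ)) * ∑ v, ((1 - p) * f σ + p * f (Function.update σ v (σ v + 1))) := by
  simp only [Matrix.mulVec, dotProduct, cyclicP, Matrix.of_apply, mul_assoc, Finset.sum_mul,
    ← Finset.mul_sum]
  rw [Finset.sum_comm]
  simp [add_mul, Finset.sum_add_distrib]

lemma cyclicP_mulVec_one {n : ℕ} (hn : n ≠ 0) (p : ℝ) :
    (cyclicP n p).mulVec (fun _ => 1) = fun _ => 1 := by
  funext σ
  rw [cyclicP_mulVec]
  simp [hn]

lemma cyclicP_half_mulVec_imbalance {n : ℕ} (hn : n ≠ 0) (A : Finset (Fin n)) :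
    (cyclicP n (1 / 2)).mulVec (fun σ => imbalance A σ - 2 * A.card / 3)
      = (1 - 3 / (2 * n) : ℝ) • fun σ => imbalance A σ - 2 * A.card / 3 := by
  funext σ
  have hn' : (n : ℝ) ≠ 0 := Nat.cast_ne_zero.mpr hn
  have hsplit : ∀ v : Fin n, (1 - 1 / 2) * (imbalance A σ - 2 * (A.card : ℝ) / 3)
      + 1 / 2 * (imbalance A (Function.update σ v (σ v + 1)) - 2 * A.card / 3)
      = (imbalance A σ - 2 * A.card / 3)
        + 1 / 2 * (imbalance A (Function.update σ v (σ v + 1)) - imbalance A σ) :=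
    fun v => by ring
  rw [cyclicP_mulVec, Finset.sum_congr rfl fun v _ => hsplit v, Finset.sum_add_distrib,
    ← Finset.mul_sum, sum_imbalance_update_sub]
  simp only [Finset.sum_const, Finset.card_univ, Fintype.card_fin, nsmul_eq_mul, Pi.smul_apply,
    smul_eq_mul]
  field_simp
  ring

lemma pow_mulVec_of_eigenvector {ι : Type*} [Fintype ι] [DecidableEq ι] {M : Matrix ι ι ℝ}
    {f : ι → ℝ} {a : ℝ} (h : M.mulVec f = a • f) (t : ℕ) : (M ^ t).mulVec f = a ^ t • f := by
  induction t with
  | zero => simp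
  | succ t ih => rw [pow_succ, ← Matrix.mulVec_mulVec, h, Matrix.mulVec_smul, ih, smul_smul,
      pow_succ']

lemma lawAt_nonneg {n : ℕ} {p : ℝ} (hp₀ : 0 ≤ p) (hp₁ : p ≤ 1) (σ₀ : Config n) (t : ℕ)
    (τ : Config n) : 0 ≤ lawAt n p σ₀ t τ := by
  have hP : ∀ σ τ, 0 ≤ cyclicP n p σ τ := fun σ τ => by
    have : 0 ≤ 1 - p := sub_nonneg.mpr hp₁
    rw [cyclicP, Matrix.of_apply]
    positivity
  unfold lawAt
  induction t generalizing τ with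
  | zero => rw [pow_zero, Matrix.one_apply]; split_ifs <;> norm_num
  | succ t ih =>
    rw [pow_succ, Matrix.mul_apply]
    exact Finset.sum_nonneg fun ρ _ => mul_nonneg (ih ρ) (hP ρ τ)

/-- The exact mean of the imbalance at time `t`. -/
lemma sum_lawAt_mul_imbalance {n : ℕ} (hn : n ≠ 0) (A : Finset (Fin n)) (σ₀ : Config n) (t : ℕ) :
    ∑ τ, lawAt n (1 / 2) σ₀ t τ * imbalance A τ
      = (1 - 3 / (2 * n) : ℝ) ^ t * (imbalance A σ₀ - 2 * A.card / 3) + 2 * A.card / 3 := by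
  have hone := congrFun (pow_mulVec_of_eigenvector (a := 1)
    (by rw [one_smul]; exact cyclicP_mulVec_one hn (1 / 2)) t) σ₀
  have hcentered := congrFun
    (pow_mulVec_of_eigenvector (cyclicP_half_mulVec_imbalance hn A) t) σ₀
  simp only [Matrix.mulVec, dotProduct, Pi.smul_apply, smul_eq_mul, mul_one, one_pow] at hone
  simp only [Matrix.mulVec, dotProduct, Pi.smul_apply, smul_eq_mul, mul_sub,
    Finset.sum_sub_distrib, ← Finset.sum_mul, hone] at hcentered
  simp only [lawAt, mul_sub]
  linarith

lemma imbalance_le_card_sq {n : ℕ} (A : Finset (Fin n)) (σ : Config n) :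
    imbalance A σ ≤ (A.card : ℝ) ^ 2 := by
  have h₀ := colorCount_nonneg A σ 0
  have h₁ := colorCount_nonneg A σ 1
  have h₂ := colorCount_nonneg A σ 2
  simp only [imbalance, ← sum_colorCount A σ, Fin.sum_univ_three]
  nlinarith [mul_nonneg h₀ h₁, mul_nonneg h₁ h₂, mul_nonneg h₀ h₂]

lemma inS_basketS_iff {n : ℕ} {B : Fin 3 → Finset (Fin n)} {m : Fin 3}
    (hB : (0 : ℝ) < (B m).card) (ρ : ℝ) (σ : Config n) :
    inS ρ (basketS B σ m)
      ↔ ∀ k, |colorCount (B m) σ k - ((B m).card : ℝ) / 3| < ρ * (B m).card := by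
  have habs : ∀ k, |basketS B σ m k - 1 / 3| < ρ
      ↔ |colorCount (B m) σ k - ((B m).card : ℝ) / 3| < ρ * (B m).card := fun k => by
    rw [basketS_eq_colorCount_div, ← div_lt_iff₀ hB, ← abs_of_pos hB, ← abs_div, abs_of_pos hB,
      sub_div, div_div, mul_comm (3 : ℝ), ← div_div, div_self hB.ne']
  refine ⟨fun h k => (habs k).mp (h.2.2 k), fun h => ⟨fun k => ?_, ?_, fun k => (habs k).mpr (h k)⟩⟩
  · rw [basketS_eq_colorCount_div]
    exact div_nonneg (colorCount_nonneg _ _ _) hB.le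
  · simp only [basketS_eq_colorCount_div, ← Finset.sum_div, sum_colorCount]
    exact div_self hB.ne'

lemma imbalance_le_of_inS {n : ℕ} {B : Fin 3 → Finset (Fin n)} {m : Fin 3}
    (hB : (0 : ℝ) < (B m).card) {ρ : ℝ} {σ : Config n} (h : inS ρ (basketS B σ m)) :
    imbalance (B m) σ ≤ 3 * (ρ * (B m).card) ^ 2 := by
  rw [inS_basketS_iff hB] at h
  calc imbalance (B m) σ ≤ ∑ _k : Fin 3, (ρ * (B m).card) ^ 2 :=
        Finset.sum_le_sum fun k _ => sq_le_sq' (abs_lt.mp (h k)).1.le (abs_lt.mp (h k)).2.le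
    _ = 3 * (ρ * (B m).card) ^ 2 := by simp

lemma sq_le_imbalance_of_not_inS {n : ℕ} {B : Fin 3 → Finset (Fin n)} {m : Fin 3}
    (hB : (0 : ℝ) < (B m).card) {ρ : ℝ} (hρ : 0 ≤ ρ) {σ : Config n}
    (h : ¬ inS ρ (basketS B σ m)) : (ρ * (B m).card) ^ 2 ≤ imbalance (B m) σ := by
  rw [inS_basketS_iff hB] at h
  push Not at h
  obtain ⟨k, hk⟩ := h
  calc (ρ * (B m).card) ^ 2 ≤ |colorCount (B m) σ k - ((B m).card : ℝ) / 3| ^ 2 :=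
        pow_le_pow_left₀ (mul_nonneg hρ hB.le) hk 2
    _ = (colorCount (B m) σ k - ((B m).card : ℝ) / 3) ^ 2 := sq_abs _
    _ ≤ imbalance (B m) σ := Finset.single_le_sum
        (f := fun k => (colorCount (B m) σ k - ((B m).card : ℝ) / 3) ^ 2)
        (fun _ _ => sq_nonneg _) (Finset.mem_univ k)

lemma contraction_pow_le_inv {n t : ℕ} (hn : 2 ≤ n) (ht : (2 / 3) * n * Real.log n ≤ (t : ℝ)) :
    (1 - 3 / (2 * n) : ℝ) ^ t ≤ 1 / n := by
  have hn₂ : (2 : ℝ) ≤ n := by exact_mod_cast hn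
  have hn₀ : (0 : ℝ) < n := by linarith
  have hbase : (0 : ℝ) ≤ 1 - 3 / (2 * n) := by
    rw [sub_nonneg, div_le_one (by positivity)]
    linarith
  calc (1 - 3 / (2 * n) : ℝ) ^ t ≤ Real.exp (-(3 / (2 * n))) ^ t :=
        pow_le_pow_left₀ hbase (Real.one_sub_le_exp_neg _) t
    _ = Real.exp (-(t * (3 / (2 * n)))) := by rw [← Real.exp_nat_mul, mul_neg]
    _ ≤ Real.exp (-Real.log n) := by
        rw [Real.exp_le_exp, neg_le_neg_iff]
        calc Real.log n = (2 / 3) * n * Real.log n * (3 / (2 * n)) := by field_simp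
          _ ≤ t * (3 / (2 * n)) := by gcongr
    _ = 1 / n := by rw [Real.exp_neg, Real.exp_log hn₀, one_div]

lemma sum_lawAt_mul_imbalance_le {n t : ℕ} (hn : 2 ≤ n) (r₀ : ℝ) {B : Fin 3 → Finset (Fin n)}
    {m : Fin 3} (hB : (0 : ℝ) < (B m).card) (σ₀ : Config n)
    (h : (2 / 3) * n * Real.log n ≤ (t : ℝ) ∨ inS (r₀ / Real.sqrt n) (basketS B σ₀ m)) :
    ∑ τ, lawAt n (1 / 2) σ₀ t τ * imbalance (B m) τ ≤ (3 * r₀ ^ 2 + 2) * n := by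
  have hn₂ : (2 : ℝ) ≤ n := by exact_mod_cast hn
  have hn₀ : (0 : ℝ) < n := by linarith
  have hbase : (0 : ℝ) ≤ 1 - 3 / (2 * n) := by
    rw [sub_nonneg, div_le_one (by positivity)]
    linarith
  have hcard : ((B m).card : ℝ) ≤ n := by
    exact_mod_cast (Finset.card_le_univ (B m)).trans_eq (Fintype.card_fin n)
  have himb : 0 ≤ imbalance (B m) σ₀ := Finset.sum_nonneg fun _ _ => sq_nonneg _
  have hcard_sq : ((B m).card : ℝ) ^ 2 ≤ (n : ℝ) ^ 2 := pow_le_pow_left₀ hB.le hcard 2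
  have hinit : (1 - 3 / (2 * n) : ℝ) ^ t * imbalance (B m) σ₀ ≤ (3 * r₀ ^ 2 + 1) * n := by
    rcases h with ht | hS
    · calc (1 - 3 / (2 * n) : ℝ) ^ t * imbalance (B m) σ₀ ≤ 1 / n * (n : ℝ) ^ 2 :=
            mul_le_mul (contraction_pow_le_inv hn ht)
              ((imbalance_le_card_sq _ _).trans hcard_sq) himb (by positivity)
        _ = n := by field_simp
        _ ≤ (3 * r₀ ^ 2 + 1) * n := by nlinarith [mul_nonneg (sq_nonneg r₀) hn₀.le]
    · calc (1 - 3 / (2 * n) : ℝ) ^ t * imbalance (B m) σ₀ ≤ 1 * imbalance (B m) σ₀ :=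
            mul_le_mul_of_nonneg_right
              (pow_le_one₀ hbase (sub_le_self _ (by positivity))) himb
        _ ≤ 3 * (r₀ / Real.sqrt n * (B m).card) ^ 2 := by
            rw [one_mul]; exact imbalance_le_of_inS hB hS
        _ = 3 * (r₀ ^ 2 / n * ((B m).card : ℝ) ^ 2) := by
            rw [mul_pow, div_pow, Real.sq_sqrt hn₀.le]
        _ ≤ 3 * (r₀ ^ 2 / n * (n : ℝ) ^ 2) := by gcongr
        _ = 3 * r₀ ^ 2 * n := by field_simp
        _ ≤ (3 * r₀ ^ 2 + 1) * n := by linarith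
  rw [sum_lawAt_mul_imbalance (by omega)]
  have hdrop : 0 ≤ (1 - 3 / (2 * n) : ℝ) ^ t * (2 * (B m).card / 3) := by positivity
  linarith

/-- concentration of the basket chain. If either `t ≥ (2/3)n log n`,
or `𝐒_0 ∈ 𝕊^{r₀/√n}` and `t ≤ γ₀ n`, then `ℙ_{σ0}(𝐒_t ∉ 𝕊^{r/√n}) ≤ C/r²` for all
sufficiently large `r` and `n`. -/
theorem basket_chain_concentration (lam r0 γ0 : ℝ)
    (hlam : 0 < lam) (hr0 : 0 < r0) (hγ0 : 0 < γ0) :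
    ∃ C : ℝ, 0 < C ∧ ∃ r1 : ℝ, ∀ r : ℝ, r1 ≤ r → ∃ N : ℕ, ∀ n : ℕ, N ≤ n →
      ∀ B : Fin 3 → Finset (Fin n),
        IsPartition B → (∀ m : Fin 3, lam * n < ((B m).card : ℝ)) →
        ∀ (t : ℕ) (σ0 : Config n),
          ((2/3) * n * Real.log n ≤ (t : ℝ)
            ∨ (inSmat (r0 / Real.sqrt n) (basketS B σ0) ∧ (t : ℝ) ≤ γ0 * n)) →
          (∑ τ : Config n,
              if ¬ inSmat (r / Real.sqrt n) (basketS B τ) then lawAt n (1/2) σ0 t τ else 0)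
            ≤ C / r ^ 2 := by
  refine ⟨3 * (3 * r0 ^ 2 + 2) / lam ^ 2, by positivity, 1, fun r hr => ⟨2, ?_⟩⟩
  intro n hn B _ hcard t σ0 hstart
  have hr₀ : 0 < r := by linarith
  have hn₀ : (0 : ℝ) < n := by exact_mod_cast (by omega : 0 < n)
  have hB : ∀ m, (0 : ℝ) < (B m).card := fun m => (mul_pos hlam hn₀).trans (hcard m)
  have hlaw : ∀ τ, 0 ≤ lawAt n (1 / 2) σ0 t τ :=
    lawAt_nonneg (by norm_num) (by norm_num) σ0 t
  have hD : 0 < r ^ 2 * lam ^ 2 * n := by positivity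
  have hmarkov : ∀ τ, (if ¬ inSmat (r / Real.sqrt n) (basketS B τ) then lawAt n (1/2) σ0 t τ else 0)
      ≤ (∑ m, lawAt n (1 / 2) σ0 t τ * imbalance (B m) τ) / (r ^ 2 * lam ^ 2 * n) := by
    intro τ
    have hterm : ∀ m ∈ Finset.univ, 0 ≤ lawAt n (1 / 2) σ0 t τ * imbalance (B m) τ := fun m _ =>
      mul_nonneg (hlaw τ) (Finset.sum_nonneg fun _ _ => sq_nonneg _)
    split_ifs with hout
    · exact div_nonneg (Finset.sum_nonneg hterm) hD.le
    · rw [inSmat, not_forall] at hout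
      obtain ⟨m, hm⟩ := hout
      rw [le_div_iff₀ hD]
      refine le_trans ?_ (Finset.single_le_sum hterm (Finset.mem_univ m))
      refine mul_le_mul_of_nonneg_left ?_ (hlaw τ)
      calc r ^ 2 * lam ^ 2 * n = r ^ 2 / n * (lam * n) ^ 2 := by field_simp
        _ ≤ r ^ 2 / n * ((B m).card : ℝ) ^ 2 := by
            have := (hcard m).le
            gcongr
        _ = (r / Real.sqrt n * (B m).card) ^ 2 := by
            rw [mul_pow, div_pow, Real.sq_sqrt hn₀.le]
        _ ≤ imbalance (B m) τ := sq_le_imbalance_of_not_inS (hB m) (by positivity) hm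
  calc _ ≤ ∑ τ, (∑ m, lawAt n (1 / 2) σ0 t τ * imbalance (B m) τ) / (r ^ 2 * lam ^ 2 * n) :=
        Finset.sum_le_sum fun τ _ => hmarkov τ
    _ = (∑ m, ∑ τ, lawAt n (1 / 2) σ0 t τ * imbalance (B m) τ) / (r ^ 2 * lam ^ 2 * n) := by
        rw [← Finset.sum_div, Finset.sum_comm]
    _ ≤ (∑ _m : Fin 3, (3 * r0 ^ 2 + 2) * n) / (r ^ 2 * lam ^ 2 * n) := by
        refine div_le_div_of_nonneg_right (Finset.sum_le_sum fun m _ => ?_) hD.le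
        exact sum_lawAt_mul_imbalance_le hn r0 (hB m) σ0 (hstart.imp_right fun h => h.1 m)
    _ = 3 * (3 * r0 ^ 2 + 2) / lam ^ 2 / r ^ 2 := by
        simp only [Finset.sum_const, Finset.card_univ, Fintype.card_fin, nsmul_eq_mul]
        push_cast
        field_simp
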